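/- Let N be a positive integer, p ∈ [0, 1/2], let V be a nonempty finite subset of ℝ^N, and let σ : ℝ → ℝ be 1-Lipschitz with σ(0) = 0. Let ε be a transductive Rademacher vector with parameter p. Then E_ε[ sup_{v ∈ V} |Σ_{n=1}^N ε_n σ(v_n)| ] ≤ 2 · E_ε[ sup_{v ∈ V} |Σ_{n=1}^N ε_n v_n| ]. -/

import Mathlib

open Finset

/-- Expectation with respect to a transductive Rademacher vector
`ε ∈ ℝ^N` with i.i.d. coordinates: `P(ε_i = 1) = P(ε_i = -1) = p`,
`P(ε_i = 0) = 1 - 2p`. -/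
noncomputable def tExp (N : ℕ) (p : ℝ) (f : (Fin N → ℝ) → ℝ) : ℝ :=
  ∑ s : Fin N → Fin 3,
    (∏ i, (![p, p, 1 - 2 * p] : Fin 3 → ℝ) (s i)) *
      f (fun i => (![(1 : ℝ), -1, 0]) (s i))

theorem tExp_succ (N : ℕ) (p : ℝ) (f : (Fin (N + 1) → ℝ) → ℝ) :
    tExp (N + 1) p f = p * tExp N p (fun ε => f (Fin.cons 1 ε)) +
      p * tExp N p (fun ε => f (Fin.cons (-1) ε)) +
      (1 - 2 * p) * tExp N p (fun ε => f (Fin.cons 0 ε)) := by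
  have key (c : Fin 3) (s : Fin N → Fin 3) :
      (fun i => (![(1 : ℝ), -1, 0]) ((Fin.cons c s : Fin (N + 1) → Fin 3) i)) =
        Fin.cons ((![(1 : ℝ), -1, 0]) c) (fun i => (![(1 : ℝ), -1, 0]) (s i)) := by
    funext i
    refine Fin.cases ?_ (fun j => ?_) i <;> simp
  unfold tExp
  rw [← (Fin.consEquiv (fun _ : Fin (N + 1) => Fin 3)).sum_comp, Fintype.sum_prod_type,
    Fin.sum_univ_three]
  simp only [Fin.consEquiv_apply, Fin.prod_univ_succ, Fin.cons_zero, Fin.cons_succ, key,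
    Finset.mul_sum, mul_assoc]
  simp

theorem tExp_mono {N : ℕ} {p : ℝ} (hp0 : 0 ≤ p) (hp : p ≤ 1 / 2) {f g : (Fin N → ℝ) → ℝ}
    (h : ∀ ε, f ε ≤ g ε) : tExp N p f ≤ tExp N p g := by
  refine Finset.sum_le_sum fun s _ => mul_le_mul_of_nonneg_left (h _) ?_
  refine Finset.prod_nonneg fun i _ => ?_
  generalize s i = c
  fin_cases c
  · simpa using hp0
  · simpa using hp0
  · simp
    linarith

theorem tExp_add (N : ℕ) (p : ℝ) (f g : (Fin N → ℝ) → ℝ) :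
    tExp N p (fun ε => f ε + g ε) = tExp N p f + tExp N p g := by
  simp only [tExp, mul_add, Finset.sum_add_distrib]

theorem tExp_comp_neg (N : ℕ) (p : ℝ) (f : (Fin N → ℝ) → ℝ) :
    tExp N p (fun ε => f (-ε)) = tExp N p f := by
  induction N with
  | zero =>
    congr 1
    funext ε
    exact congrArg f (Subsingleton.elim _ _)
  | succ N ih =>
    have key (c : ℝ) (ε : Fin N → ℝ) :
        -(Fin.cons c ε : Fin (N + 1) → ℝ) = Fin.cons (-c) (-ε) := by
      funext i
      refine Fin.cases ?_ (fun j => ?_) i <;> simp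
    simp only [tExp_succ, key]
    rw [ih (fun ε => f (Fin.cons (-1) ε)), ih (fun ε => f (Fin.cons (- -1) ε)),
      ih (fun ε => f (Fin.cons (-0) ε)), neg_neg, neg_zero]
    ring

theorem sup'_add_add_sup'_sub_le {ι : Type*} (T : Finset ι) (hT : T.Nonempty)
    (b x y : ι → ℝ) (h : ∀ i ∈ T, ∀ j ∈ T, |x i - x j| ≤ |y i - y j|) :
    T.sup' hT (fun i => b i + x i) + T.sup' hT (fun i => b i - x i) ≤
      T.sup' hT (fun i => b i + y i) + T.sup' hT (fun i => b i - y i) := by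
  obtain ⟨i, hi, hi'⟩ := T.exists_mem_eq_sup' hT (fun i => b i + x i)
  obtain ⟨j, hj, hj'⟩ := T.exists_mem_eq_sup' hT (fun i => b i - x i)
  have hij := (le_abs_self _).trans (h i hi j hj)
  have h1 := T.le_sup' (fun i => b i + y i) hi
  have h2 := T.le_sup' (fun i => b i - y i) hj
  have h3 := T.le_sup' (fun i => b i + y i) hj
  have h4 := T.le_sup' (fun i => b i - y i) hi
  rw [hi', hj']
  rcases abs_cases (y i - y j) with ⟨h5, _⟩ | ⟨h5, _⟩ <;> linarith

/-- Contraction for suprema of affine functions of a transductive Rademacher vector,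
without absolute values. -/
theorem tExp_sup'_le_of_abs_sub_le {ι : Type*} {p : ℝ} (hp0 : 0 ≤ p) (hp : p ≤ 1 / 2)
    (T : Finset ι) (hT : T.Nonempty) (N : ℕ) (a : ι → ℝ) (x y : ι → Fin N → ℝ)
    (h : ∀ i ∈ T, ∀ j ∈ T, ∀ n, |x i n - x j n| ≤ |y i n - y j n|) :
    tExp N p (fun ε => T.sup' hT (fun i => a i + ∑ n, ε n * x i n)) ≤
      tExp N p (fun ε => T.sup' hT (fun i => a i + ∑ n, ε n * y i n)) := by
  induction N generalizing a with
  | zero => simp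
  | succ N ih =>
    have IH (c : ℝ) := ih (fun i => a i + c * x i 0) (fun i n => x i n.succ)
      (fun i n => y i n.succ) (fun i hi j hj n => h i hi j hj n.succ)
    have hpm : tExp N p (fun ε => T.sup' hT
          (fun i => a i + 1 * x i 0 + ∑ n, ε n * y i n.succ)) +
        tExp N p (fun ε => T.sup' hT
          (fun i => a i + (-1) * x i 0 + ∑ n, ε n * y i n.succ)) ≤
        tExp N p (fun ε => T.sup' hT
          (fun i => a i + 1 * y i 0 + ∑ n, ε n * y i n.succ)) +
        tExp N p (fun ε => T.sup' hT
          (fun i => a i + (-1) * y i 0 + ∑ n, ε n * y i n.succ)) := by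
      rw [← tExp_add, ← tExp_add]
      refine tExp_mono hp0 hp fun ε => ?_
      convert sup'_add_add_sup'_sub_le T hT (fun i => a i + ∑ n, ε n * y i n.succ)
        (fun i => x i 0) (fun i => y i 0) (fun i hi j hj => h i hi j hj 0) using 3 <;> ring
    have h0 := mul_le_mul_of_nonneg_left (IH 0) (by linarith : 0 ≤ 1 - 2 * p)
    have h1 := mul_le_mul_of_nonneg_left ((add_le_add (IH 1) (IH (-1))).trans hpm) hp0
    simp only [tExp_succ, Fin.sum_univ_succ, Fin.cons_zero, Fin.cons_succ, ← add_assoc]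
    simp only [zero_mul] at h0 ⊢
    linarith

/-- Contraction inequality for the symmetric transductive Rademacher
complexity: `R̄(σ ∘ V, p) ≤ 2 R̄(V, p)` for a 1-Lipschitz `σ` with `σ(0) = 0`. -/
theorem rademacher_contraction
    (N : ℕ) (hN : 0 < N) (p : ℝ) (hp0 : 0 ≤ p) (hp : p ≤ 1 / 2)
    (V : Finset (Fin N → ℝ)) (hV : V.Nonempty)
    (σ : ℝ → ℝ) (hσ : LipschitzWith 1 σ) (hσ0 : σ 0 = 0) :
    tExp N p (fun ε => V.sup' hV (fun v => |∑ n, ε n * σ (v n)|))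
      ≤ 2 * tExp N p (fun ε => V.sup' hV (fun v => |∑ n, ε n * v n|)) := by
  classical
  have hW : (insert 0 V).Nonempty := Finset.insert_nonempty 0 V
  set g : (Fin N → ℝ) → ℝ := fun ε =>
    (insert 0 V).sup' hW (fun v => 0 + ∑ n, ε n * σ (v n)) with hg
  have hle : tExp N p (fun ε => V.sup' hV (fun v => |∑ n, ε n * σ (v n)|)) ≤
      tExp N p (fun ε => g ε + g (-ε)) := by
    refine tExp_mono hp0 hp fun ε => Finset.sup'_le _ _ fun v hv => ?_
    have hg0 (ε : Fin N → ℝ) : 0 ≤ g ε := by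
      simp [hg, hσ0]
    have hgv (ε : Fin N → ℝ) : ∑ n, ε n * σ (v n) ≤ g ε := by
      have := Finset.le_sup' (fun v : Fin N → ℝ => 0 + ∑ n, ε n * σ (v n))
        (Finset.mem_insert_of_mem (b := 0) hv)
      simpa only [hg, zero_add] using this
    have hneg := hgv (-ε)
    simp only [Pi.neg_apply, neg_mul, Finset.sum_neg_distrib] at hneg
    exact abs_le'.2 ⟨by linarith [hgv ε, hg0 (-ε)], by linarith [hg0 ε]⟩
  have hcontr : tExp N p g ≤ tExp N p (fun ε => V.sup' hV (fun v => |∑ n, ε n * v n|)) := by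
    refine (tExp_sup'_le_of_abs_sub_le hp0 hp (insert 0 V) hW N (fun _ => 0)
      (fun v n => σ (v n)) (fun v => v) fun v _ w _ n => ?_).trans
      (tExp_mono hp0 hp fun ε => Finset.sup'_le _ _ fun v hv => ?_)
    · simpa [Real.dist_eq] using hσ.dist_le_mul (v n) (w n)
    · rw [zero_add]
      rcases Finset.mem_insert.1 hv with rfl | hv
      · obtain ⟨w, hw⟩ := hV
        refine le_trans ?_ (Finset.le_sup' (fun v : Fin N → ℝ => |∑ n, ε n * v n|) hw)
        simp
      · exact (le_abs_self _).trans
          (Finset.le_sup' (fun v : Fin N → ℝ => |∑ n, ε n * v n|) hv)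
  rw [tExp_add, tExp_comp_neg] at hle
  linarith
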